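/- Let (S₁,R₁) and (S₂,R₂) be two Artin-Tits presentations satisfying Property H# with S₁ ∩ S₂ = ∅, and let R₁,₂ = {s₁s₂ = s₂s₁ : s₁ ∈ S₁, s₂ ∈ S₂}. Then the Artin-Tits presentation (S₁ ∪ S₂, R₁ ∪ R₂ ∪ R₁,₂), whose group is isomorphic to the direct product A_{S₁} × A_{S₂}, satisfies Property H#. -/

import Mathlib

namespace ArtinTits

open Classical List

variable {S : Type*}

/-- A word over `S ∪ S⁻¹`: a list of letters, each a generator together with a sign
(`true` = the generator itself, `false` = its formal inverse). -/
abbrev Word (S : Type*) := List (S × Bool)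

/-- The formal inverse of a word. -/
def wordInv (w : Word S) : Word S := w.reverse.map fun l => (l.1, !l.2)

/-- `[x,y,j⟩`: the alternating positive word `xyxy⋯` with `j` letters, beginning with `x`. -/
def altWord (x y : S) : ℕ → Word S
  | 0 => []
  | j + 1 => (x, true) :: altWord y x j

/-- `⟨x,y,j]`: the alternating positive word `⋯xy` with `j` letters, ending with `y`. -/
def altWordR (x y : S) (j : ℕ) : Word S := (altWord y x j).reverse

/-- The data of a labelled finite complete simplicial graph `Γ₀`: a symmetric label map
with values in `{2,3,…} ∪ {∞}` on pairs of distinct vertices. -/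
structure ArtinData (S : Type*) where
  m : S → S → ℕ∞
  symm : ∀ s t, m s t = m t s
  two_le : ∀ s t : S, s ≠ t → 2 ≤ m s t

/-- `u = v` is a defining (braid) relation of the Artin–Tits presentation. -/
def IsRel (A : ArtinData S) (u v : Word S) : Prop :=
  ∃ (s t : S) (k : ℕ), s ≠ t ∧ A.m s t = (k : ℕ∞) ∧
    u = altWord s t k ∧ v = altWord t s k

/-- The relator set of the Artin–Tits presentation, inside the free group. -/
def rels (A : ArtinData S) : Set (FreeGroup S) :=
  {x | ∃ u v : Word S, IsRel A u v ∧ x = FreeGroup.mk u * (FreeGroup.mk v)⁻¹}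

/-- The Artin–Tits group `A(Γ₀)` of the presentation. -/
abbrev ArtinGroup (A : ArtinData S) := PresentedGroup (rels A)

/-- `w̄`: the element of the Artin–Tits group represented by the word `w`. -/
def wbar (A : ArtinData S) (w : Word S) : ArtinGroup A :=
  PresentedGroup.mk (rels A) (FreeGroup.mk w)

/-! ### Special transformations -/

/-- Type 0: delete a factor `s s⁻¹` or `s⁻¹ s`. -/
def Step0 (w w' : Word S) : Prop :=
  ∃ (w₁ w₂ : Word S) (s : S) (b : Bool),
    w = w₁ ++ [(s, b), (s, !b)] ++ w₂ ∧ w' = w₁ ++ w₂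

/-- Type ∞: insert a factor `s s⁻¹` or `s⁻¹ s` (the inverse of type 0). -/
def StepInfty (w w' : Word S) : Prop := Step0 w' w

/-- Type 1: replace a factor `v` by `u`, or `v⁻¹` by `u⁻¹`, where `u = v` is a defining
relation. -/
def Step1 (A : ArtinData S) (w w' : Word S) : Prop :=
  ∃ (w₁ w₂ u v : Word S), IsRel A u v ∧
    ((w = w₁ ++ v ++ w₂ ∧ w' = w₁ ++ u ++ w₂) ∨
     (w = w₁ ++ wordInv v ++ w₂ ∧ w' = w₁ ++ wordInv u ++ w₂))

/-- Type 2r: for a defining relation `u₁u₂ = v₁v₂` with `u₁, v₁` non-empty, replace a factor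
`v₁⁻¹ u₁` by `v₂ u₂⁻¹`. -/
def Step2r (A : ArtinData S) (w w' : Word S) : Prop :=
  ∃ (w₁ w₂ u₁ u₂ v₁ v₂ : Word S), IsRel A (u₁ ++ u₂) (v₁ ++ v₂) ∧
    u₁ ≠ [] ∧ v₁ ≠ [] ∧
    w = w₁ ++ wordInv v₁ ++ u₁ ++ w₂ ∧ w' = w₁ ++ v₂ ++ wordInv u₂ ++ w₂

/-- Type 2l: for a defining relation `u₁u₂ = v₁v₂` with `u₂, v₂` non-empty, replace a factor
`v₂ u₂⁻¹` by `v₁⁻¹ u₁`. -/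
def Step2l (A : ArtinData S) (w w' : Word S) : Prop :=
  ∃ (w₁ w₂ u₁ u₂ v₁ v₂ : Word S), IsRel A (u₁ ++ u₂) (v₁ ++ v₂) ∧
    u₂ ≠ [] ∧ v₂ ≠ [] ∧
    w = w₁ ++ v₂ ++ wordInv u₂ ++ w₂ ∧ w' = w₁ ++ wordInv v₁ ++ u₁ ++ w₂

/-- Type 2: a type 2r or type 2l transformation. -/
def Step2 (A : ArtinData S) (w w' : Word S) : Prop := Step2r A w w' ∨ Step2l A w w'

/-- `p` is the greatest (longest) common left factor of `x` and `y`. -/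
def IsLCPrefix (p x y : Word S) : Prop :=
  p <+: x ∧ p <+: y ∧ ∀ q : Word S, q <+: x → q <+: y → q.length ≤ p.length

/-- `p` is the greatest (longest) common right factor of `x` and `y`. -/
def IsLCSuffix (p x y : Word S) : Prop :=
  p <:+ x ∧ p <:+ y ∧ ∀ q : Word S, q <:+ x → q <:+ y → q.length ≤ p.length

/-- Type 2r⋆ : a type 2r transformation `w₁ v⁻¹ v' w₂ → w₁ u (u')⁻¹ w₂` (with `vu = v'u'` a
defining relation) such that `v` is the greatest common left factor of `vu` and `v w₁⁻¹`, and
`v'` is the greatest common left factor of `v'u'` and `v' w₂`. -/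
def Step2rStar (A : ArtinData S) (w w' : Word S) : Prop :=
  ∃ (w₁ w₂ v u v' u' : Word S), IsRel A (v ++ u) (v' ++ u') ∧
    v ≠ [] ∧ v' ≠ [] ∧
    w = w₁ ++ wordInv v ++ v' ++ w₂ ∧
    w' = w₁ ++ u ++ wordInv u' ++ w₂ ∧
    IsLCPrefix v (v ++ u) (v ++ wordInv w₁) ∧
    IsLCPrefix v' (v' ++ u') (v' ++ w₂)

/-- Type 2l⋆ : a type 2l transformation `w₁ v (v')⁻¹ w₂ → w₁ u⁻¹ u' w₂` (with `uv = u'v'` a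
defining relation) such that `v` is the greatest common right factor of `uv` and `w₁ v`, and
`v'` is the greatest common right factor of `u'v'` and `w₂⁻¹ v'`. -/
def Step2lStar (A : ArtinData S) (w w' : Word S) : Prop :=
  ∃ (w₁ w₂ v u v' u' : Word S), IsRel A (u ++ v) (u' ++ v') ∧
    v ≠ [] ∧ v' ≠ [] ∧
    w = w₁ ++ v ++ wordInv v' ++ w₂ ∧
    w' = w₁ ++ wordInv u ++ u' ++ w₂ ∧
    IsLCSuffix v (u ++ v) (w₁ ++ v) ∧
    IsLCSuffix v' (u' ++ v') (wordInv w₂ ++ v')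

/-- Type 2⋆ : a type 2r⋆ or type 2l⋆ transformation. -/
def Step2Star (A : ArtinData S) (w w' : Word S) : Prop :=
  Step2rStar A w w' ∨ Step2lStar A w w'

/-- `w →_{0,1,2} w'`. -/
def Steps012 (A : ArtinData S) : Word S → Word S → Prop :=
  Relation.ReflTransGen fun x y => Step0 x y ∨ Step1 A x y ∨ Step2 A x y

/-- `w →_{0,1,2⋆} w'`. -/
def Steps012Star (A : ArtinData S) : Word S → Word S → Prop :=
  Relation.ReflTransGen fun x y => Step0 x y ∨ Step1 A x y ∨ Step2Star A x y

/-- `w →_{2⋆} w'`. -/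
def Steps2Star (A : ArtinData S) : Word S → Word S → Prop :=
  Relation.ReflTransGen (Step2Star A)

/-- `w →_{1,2⋆} w'`. -/
def Steps12Star (A : ArtinData S) : Word S → Word S → Prop :=
  Relation.ReflTransGen fun x y => Step1 A x y ∨ Step2Star A x y

/-- `w →_{1,2} w'`. -/
def Steps12 (A : ArtinData S) : Word S → Word S → Prop :=
  Relation.ReflTransGen fun x y => Step1 A x y ∨ Step2 A x y

/-! ### Classes of words -/

/-- A positive word: written over `S`. -/
def Positive (w : Word S) : Prop := ∀ l ∈ w, l.2 = true

/-- A negative word: written over `S⁻¹`. -/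
def Negative (w : Word S) : Prop := ∀ l ∈ w, l.2 = false

/-- A signed word: positive or negative. -/
def Signed (w : Word S) : Prop := Positive w ∨ Negative w

/-- An unsigned word: neither positive nor negative. -/
def Unsigned (w : Word S) : Prop := ¬ Positive w ∧ ¬ Negative w

/-- A freely reduced word: no factor `s s⁻¹` or `s⁻¹ s`. -/
def FreelyReduced (w : Word S) : Prop :=
  ∀ (w₁ w₂ : Word S) (s : S) (b : Bool), w ≠ w₁ ++ [(s, b), (s, !b)] ++ w₂

/-- A square-free word: no factor `aa`. -/
def SquareFree (w : Word S) : Prop := ∀ a : S × Bool, ¬ [a, a] <:+: w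

/-- `p̃(w)`: the length of the longest square-free positive factor of `w`. -/
noncomputable def ptilde (w : Word S) : ℕ :=
  sSup {n | ∃ v : Word S, v <:+: w ∧ Positive v ∧ SquareFree v ∧ v.length = n}

/-- `ñ(w)`: the length of the longest negative factor of `w` whose formal inverse is
square-free. -/
noncomputable def ntilde (w : Word S) : ℕ :=
  sSup {n | ∃ v : Word S, v <:+: w ∧ Negative v ∧ SquareFree (wordInv v) ∧ v.length = n}

/-- `p(w) = min(p̃(w), m)`. -/
noncomputable def pfun (M : ℕ) (w : Word S) : ℕ := min (ptilde w) M

/-- `n(w) = min(ñ(w), m)`. -/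
noncomputable def nfun (M : ℕ) (w : Word S) : ℕ := min (ntilde w) M

/-- `Ω(Γ₀)` (for a dihedral presentation with label `M`): the freely reduced words with
`max(p(w), n(w)) < M`. -/
def Omega (M : ℕ) (w : Word S) : Prop :=
  FreelyReduced w ∧ max (pfun M w) (nfun M w) < M

/-- A signed square-free word (square-free positive, or negative with square-free inverse). -/
def SignedSF (w : Word S) : Prop :=
  (Positive w ∧ SquareFree w) ∨ (Negative w ∧ SquareFree (wordInv w))

/-- `v` is the maximal square-free signed left factor of `w`. -/
def MaxSignedSFPrefix (v w : Word S) : Prop :=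
  v <+: w ∧ SignedSF v ∧ ∀ v' : Word S, v' <+: w → SignedSF v' → v'.length ≤ v.length

/-- `(v₁, …, v_k)` is the `⋆`-decomposition of `w`: the `v_i` are non-empty, `w = v₁⋯v_k`,
and each `v_i` is the maximal square-free signed left factor of `v_i⋯v_k`. -/
def StarDecomp (w : Word S) (L : List (Word S)) : Prop :=
  w = L.flatten ∧ (∀ v ∈ L, v ≠ ([] : Word S)) ∧
    ∀ i (h : i < L.length), MaxSignedSFPrefix (L.get ⟨i, h⟩) ((L.drop i).flatten)

/-! ### Groups, parabolic subgroups, geodesics -/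

/-- A word written over `T ∪ T⁻¹` for a subset `T` of the generators. -/
def WordOver (T : Set S) (w : Word S) : Prop := ∀ l ∈ w, l.1 ∈ T

/-- The standard parabolic subgroup `A_T` generated by the image of `T ⊆ S`. -/
def parab (A : ArtinData S) (T : Set S) : Subgroup (ArtinGroup A) :=
  Subgroup.closure {x | ∃ s ∈ T, x = wbar A [(s, true)]}

/-- A geodesic word: of minimal length among all words representing the same element. -/
def Geodesic (A : ArtinData S) (w : Word S) : Prop :=
  ∀ w' : Word S, wbar A w' = wbar A w → w.length ≤ w'.length

/-- A word over `T ∪ T⁻¹` that is geodesic among the words over `T ∪ T⁻¹` representing the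
same element. -/
def GeodesicOver (A : ArtinData S) (T : Set S) (w : Word S) : Prop :=
  WordOver T w ∧
    ∀ w' : Word S, WordOver T w' → wbar A w' = wbar A w → w.length ≤ w'.length

/-- The length of a group element: the length of any geodesic representative word. -/
noncomputable def elLength (A : ArtinData S) (g : ArtinGroup A) : ℕ :=
  sInf {n | ∃ w : Word S, wbar A w = g ∧ w.length = n}

/-- A positive element: one represented by a positive word. -/
def IsPosElt (A : ArtinData S) (g : ArtinGroup A) : Prop :=
  ∃ w : Word S, Positive w ∧ wbar A w = g

/-- An `H`-transversal: a subset containing `1` and exactly one element of each left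
`H`-coset. -/
def IsLeftTransversal {G : Type*} [Group G] (H : Subgroup G) (T : Set G) : Prop :=
  (1 : G) ∈ T ∧ ∀ g : G, ∃! x, x ∈ T ∧ g⁻¹ * x ∈ H

/-! ### Properties H, H⁺, H# -/

/-- Property `H`: `w →_{0,1,2} ε ↔ w̄ = 1`. -/
def PropertyH (A : ArtinData S) : Prop :=
  ∀ w : Word S, Steps012 A w [] ↔ wbar A w = 1

/-- Property `H⁺`: every word representing an element of a standard parabolic subgroup
`A_{S₀}` can be transformed by `→_{0,1,2⋆}` into a word over `S₀ ∪ S₀⁻¹`. -/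
def PropertyHPlus (A : ArtinData S) : Prop :=
  ∀ (S₀ : Set S) (w : Word S), wbar A w ∈ parab A S₀ →
    ∃ w₀ : Word S, WordOver S₀ w₀ ∧ Steps012Star A w w₀

/-- Property `H#` with respect to an `S`-sequence of transversals `T`. -/
def PropertyHSharpWrt (A : ArtinData S) (T : Set S → Set (ArtinGroup A)) : Prop :=
  (∀ S₀ : Set S, IsLeftTransversal (parab A S₀) (T S₀)) ∧
    ∀ (S' S₀ : Set S) (w : Word S), wbar A w ∈ parab A S' →
      ∃ v u : Word S, WordOver S' v ∧ WordOver (S' ∩ S₀) u ∧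
        Steps012 A w (v ++ u) ∧ wbar A v ∈ T S₀

/-- Property `H#`: property `H#` with respect to some `S`-sequence of transversals. -/
def PropertyHSharp (A : ArtinData S) : Prop :=
  ∃ T : Set S → Set (ArtinGroup A), PropertyHSharpWrt A T

/-! ### Critical words and the involution τ (relative to a dihedral pair) -/

/-- The permutation `δ` induced by conjugation by `Δ`, extended letterwise to words:
the identity if `M` is even, and the swap of `s` and `t` if `M` is odd. -/
noncomputable def deltaMap (s t : S) (M : ℕ) (w : Word S) : Word S :=
  if Even M then w
  else w.map fun l => (if l.1 = s then t else if l.1 = t then s else l.1, l.2)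

/-- `w` is an unsigned critical word (of the dihedral pair `{s,t}` with label `M`) and
`w' = τ(w)`. -/
def UCritTauPair (A : ArtinData S) (s t : S) (M : ℕ) (w w' : Word S) : Prop :=
  WordOver {s, t} w ∧ FreelyReduced w ∧ Unsigned w ∧ GeodesicOver A {s, t} w ∧
  pfun M w + nfun M w = M ∧
  ∃ (x y z z' : S) (wm : Word S),
    ({x, y} : Set S) = {s, t} ∧ ({z, z'} : Set S) = {s, t} ∧
    ((w = altWord x y (pfun M w) ++ wm ++ wordInv (altWord z z' (nfun M w)) ∧
      w' = wordInv (altWordR x y (nfun M w)) ++ deltaMap s t M wm ++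
        altWordR z z' (pfun M w)) ∨
     (w = wordInv (altWordR x y (nfun M w)) ++ wm ++ altWordR z z' (pfun M w) ∧
      w' = altWord x y (pfun M w) ++ deltaMap s t M wm ++
        wordInv (altWord z z' (nfun M w))))

/-- `w` is a positive critical word (of the dihedral pair `{s,t}` with label `M`) and
`w' = τ(w)`. -/
def PosCritTauPair (A : ArtinData S) (s t : S) (M : ℕ) (w w' : Word S) : Prop :=
  WordOver {s, t} w ∧ Positive w ∧ pfun M w = M ∧
  ∃ (x y : S) (wm : Word S), ({x, y} : Set S) = {s, t} ∧ pfun M wm < M ∧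
    ((w = altWord x y M ++ wm ∧
      (w' = deltaMap s t M wm ++ altWordR x y M ∨
       w' = deltaMap s t M wm ++ altWordR y x M) ∧
      w'.getLast? ≠ w.getLast?) ∨
     (w = wm ++ altWordR x y M ∧
      (w' = altWord x y M ++ deltaMap s t M wm ∨
       w' = altWord y x M ++ deltaMap s t M wm) ∧
      w'.head? ≠ w.head?))

/-- `w` is a negative critical word and `w' = τ(w)` (defined via formal inverses). -/
def NegCritTauPair (A : ArtinData S) (s t : S) (M : ℕ) (w w' : Word S) : Prop :=
  PosCritTauPair A s t M (wordInv w) (wordInv w')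

/-- `w` is a critical word (unsigned, positive or negative) and `w' = τ(w)`. -/
def CritTauPair (A : ArtinData S) (s t : S) (M : ℕ) (w w' : Word S) : Prop :=
  UCritTauPair A s t M w w' ∨ PosCritTauPair A s t M w w' ∨ NegCritTauPair A s t M w w'

/-- A type β transformation relative to the dihedral pair `{s,t}` with label `M`:
replace a critical factor `v` by `τ(v)`. -/
def StepBetaPair (A : ArtinData S) (s t : S) (M : ℕ) (w w' : Word S) : Prop :=
  ∃ (w₁ w₂ v v' : Word S), w = w₁ ++ v ++ w₂ ∧ w' = w₁ ++ v' ++ w₂ ∧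
    CritTauPair A s t M v v'

/-- A type β transformation (in an Artin–Tits group): a type β transformation relative to some
dihedral standard parabolic subgroup (a pair of generators with finite label). -/
def StepBeta (A : ArtinData S) (w w' : Word S) : Prop :=
  ∃ (s t : S) (M : ℕ), s ≠ t ∧ A.m s t = (M : ℕ∞) ∧ StepBetaPair A s t M w w'

/-! ### Restriction, direct products, Coxeter graph notions -/

/-- The Artin–Tits presentation induced on a subset `T` of the generators (the presentation of
the standard parabolic subgroup `A_T`). -/
def ArtinData.restrict (A : ArtinData S) (T : Set S) : ArtinData T where
  m a b := A.m a b
  symm a b := A.symm a b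
  two_le a b h := A.two_le a b fun h' => h (Subtype.ext h')

/-- The Artin–Tits presentation on the disjoint union `S₁ ⊕ S₂` obtained from presentations on
`S₁` and `S₂` by adding the commuting relations `s₁s₂ = s₂s₁` (label `2`) for `s₁ ∈ S₁`,
`s₂ ∈ S₂`. -/
def prodData {S₁ S₂ : Type*} (A₁ : ArtinData S₁) (A₂ : ArtinData S₂) :
    ArtinData (S₁ ⊕ S₂) where
  m x y :=
    match x, y with
    | Sum.inl a, Sum.inl b => A₁.m a b
    | Sum.inr a, Sum.inr b => A₂.m a b
    | _, _ => 2
  symm x y := by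
    cases x <;> cases y
    · exact A₁.symm _ _
    · rfl
    · rfl
    · exact A₂.symm _ _
  two_le x y h := by
    cases x <;> cases y
    · exact A₁.two_le _ _ fun h' => h (congrArg Sum.inl h')
    · exact le_rfl
    · exact le_rfl
    · exact A₂.two_le _ _ fun h' => h (congrArg Sum.inr h')

/-- Adjacency in the Coxeter graph `Γ` restricted to `T`: distinct vertices of `T` joined by an
edge (i.e. with label `≠ 2`, edges labelled `2` being removed in `Γ`). -/
def coxAdj (A : ArtinData S) (T : Set S) (x y : S) : Prop :=
  x ∈ T ∧ y ∈ T ∧ x ≠ y ∧ A.m x y ≠ 2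

/-- The full subgraph of the Coxeter graph on the vertex subset `T` is connected. -/
def CoxConnected (A : ArtinData S) (T : Set S) : Prop :=
  ∀ x ∈ T, ∀ y ∈ T, Relation.ReflTransGen (coxAdj A T) x y

/-- The relator set of the Coxeter presentation on `T`: the Artin relations together with the
squares of the generators. -/
def coxRels (A : ArtinData S) (T : Set S) : Set (FreeGroup T) :=
  rels (A.restrict T) ∪ {g | ∃ x : T, g = FreeGroup.of x * FreeGroup.of x}

/-- The induced presentation on `T` is of spherical type: its Coxeter group is finite. -/
def SphericalType (A : ArtinData S) (T : Set S) : Prop :=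
  Finite (PresentedGroup (coxRels A T))

/-- The induced presentation on `T` is of large type: all labels are `≥ 3` (possibly `∞`). -/
def LargeTypeOn (A : ArtinData S) (T : Set S) : Prop :=
  ∀ x ∈ T, ∀ y ∈ T, x ≠ y → 3 ≤ A.m x y

/-! ### Words and group elements -/

theorem wbar_append (A : ArtinData S) (u v : Word S) :
    wbar A (u ++ v) = wbar A u * wbar A v := by
  simp only [wbar, ← FreeGroup.mul_mk, map_mul]

theorem wbar_cons (A : ArtinData S) (l : S × Bool) (w : Word S) :
    wbar A (l :: w) = wbar A [l] * wbar A w :=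
  wbar_append A [l] w

theorem wbar_false (A : ArtinData S) (s : S) :
    wbar A [(s, false)] = (wbar A [(s, true)])⁻¹ := by
  simp only [wbar, ← map_inv]
  rfl

theorem wbar_eq_of_isRel (A : ArtinData S) {u v : Word S} (h : IsRel A u v) :
    wbar A u = wbar A v := by
  have : PresentedGroup.mk (rels A) (FreeGroup.mk u * (FreeGroup.mk v)⁻¹) = 1 :=
    PresentedGroup.mk_eq_one_iff.2 (Subgroup.subset_normalClosure ⟨u, v, h, rfl⟩)
  rw [map_mul, map_inv, mul_inv_eq_one] at this
  exact this

/-- A map on generators whose values satisfy the defining relations induces a group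
homomorphism. -/
theorem exists_hom_of_isRel {G : Type*} [Group G] (A : ArtinData S) (f : S → G)
    (h : ∀ u v, IsRel A u v →
      FreeGroup.lift f (FreeGroup.mk u) = FreeGroup.lift f (FreeGroup.mk v)) :
    ∃ φ : ArtinGroup A →* G, ∀ s, φ (wbar A [(s, true)]) = f s := by
  have hr : ∀ r ∈ rels A, FreeGroup.lift f r = 1 := by
    rintro r ⟨u, v, huv, rfl⟩
    rw [map_mul, map_inv, h u v huv, mul_inv_cancel]
  exact ⟨PresentedGroup.toGroup hr, fun s => PresentedGroup.toGroup.of hr⟩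

theorem hom_ext_wbar {G : Type*} [Group G] (A : ArtinData S) {φ ψ : ArtinGroup A →* G}
    (h : ∀ s, φ (wbar A [(s, true)]) = ψ (wbar A [(s, true)])) : φ = ψ :=
  PresentedGroup.ext h

theorem lift_altWord_congr {T G H : Type*} [Group G] [Group H] (φ : G →* H) (f : S → H) (g : T → G)
    {s t : S} {s' t' : T} (hs : f s = φ (g s')) (ht : f t = φ (g t')) (k : ℕ) :
    FreeGroup.lift f (FreeGroup.mk (altWord s t k)) =
      φ (FreeGroup.lift g (FreeGroup.mk (altWord s' t' k))) := by
  induction k generalizing s t s' t' with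
  | zero => simp [altWord]
  | succ k ih =>
    have := ih ht hs
    simp only [FreeGroup.lift_mk] at this ⊢
    simp [altWord, hs, this]

theorem lift_of_wbar (A : ArtinData S) (w : Word S) :
    FreeGroup.lift (fun s => wbar A [(s, true)]) (FreeGroup.mk w) = wbar A w := by
  have : FreeGroup.lift (fun s => wbar A [(s, true)]) = PresentedGroup.mk (rels A) := by
    ext s
    simp [wbar, FreeGroup.of]
  rw [this]
  rfl

theorem lift_altWord (A : ArtinData S) {T G : Type*} [Group G] (φ : ArtinGroup A →* G)
    (f : T → G) {s t : T} {s' t' : S} (hs : f s = φ (wbar A [(s', true)]))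
    (ht : f t = φ (wbar A [(t', true)])) (k : ℕ) :
    FreeGroup.lift f (FreeGroup.mk (altWord s t k)) = φ (wbar A (altWord s' t' k)) := by
  rw [lift_altWord_congr φ f (fun s => wbar A [(s, true)]) hs ht, lift_of_wbar]

/-! ### Renaming generators -/

/-- The word obtained by applying `f` to every generator. -/
def mapWord {T : Type*} (f : S → T) (w : Word S) : Word T := w.map (Prod.map f id)

theorem mapWord_append {T : Type*} (f : S → T) (u v : Word S) :
    mapWord f (u ++ v) = mapWord f u ++ mapWord f v := List.map_append

theorem mapWord_wordInv {T : Type*} (f : S → T) (w : Word S) :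
    mapWord f (wordInv w) = wordInv (mapWord f w) := by
  simp [mapWord, wordInv, Function.comp_def]

theorem mapWord_altWord {T : Type*} (f : S → T) (s t : S) (k : ℕ) :
    mapWord f (altWord s t k) = altWord (f s) (f t) k := by
  induction k generalizing s t with
  | zero => rfl
  | succ k ih => simpa [mapWord, altWord] using ih t s

theorem mapWord_ne_nil {T : Type*} (f : S → T) {w : Word S} (h : w ≠ []) : mapWord f w ≠ [] := by
  simpa [mapWord] using h

theorem wordOver_mapWord {T : Type*} (f : S → T) {U : Set T} {w : Word S}
    (h : WordOver (f ⁻¹' U) w) : WordOver U (mapWord f w) := by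
  intro l hl
  obtain ⟨l', hl', rfl⟩ := List.mem_map.1 hl
  exact h l' hl'

theorem WordOver.append {U : Set S} {u v : Word S} (hu : WordOver U u) (hv : WordOver U v) :
    WordOver U (u ++ v) := fun l hl => (List.mem_append.1 hl).elim (hu l) (hv l)

/-- An injection of generators preserving the labels. -/
def LabelEmbedding {T : Type*} (A : ArtinData S) (B : ArtinData T) (f : S → T) : Prop :=
  Function.Injective f ∧ ∀ s t, B.m (f s) (f t) = A.m s t

theorem IsRel.mapWord {T : Type*} {A : ArtinData S} {B : ArtinData T} {f : S → T}
    (hf : LabelEmbedding A B f) {u v : Word S} (h : IsRel A u v) :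
    IsRel B (mapWord f u) (mapWord f v) := by
  obtain ⟨s, t, k, hst, hm, rfl, rfl⟩ := h
  exact ⟨f s, f t, k, hf.1.ne hst, by rw [hf.2, hm], mapWord_altWord f s t k,
    mapWord_altWord f t s k⟩

theorem Steps012.mapWord {T : Type*} {A : ArtinData S} {B : ArtinData T} {f : S → T}
    (hf : LabelEmbedding A B f) {w w' : Word S} (h : Steps012 A w w') :
    Steps012 B (mapWord f w) (mapWord f w') := by
  refine Relation.ReflTransGen.lift (ArtinTits.mapWord f) ?_ _ _ h
  rintro x y (⟨w₁, w₂, s, b, rfl, rfl⟩ | ⟨w₁, w₂, u, v, hr, h⟩ |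
    ⟨w₁, w₂, u₁, u₂, v₁, v₂, hr, hu, hv, rfl, rfl⟩ | ⟨w₁, w₂, u₁, u₂, v₁, v₂, hr, hu, hv, rfl, rfl⟩)
  · exact Or.inl ⟨_, _, f s, b, by simp only [mapWord_append]; rfl, mapWord_append _ _ _⟩
  · refine Or.inr (Or.inl ⟨ArtinTits.mapWord f w₁, ArtinTits.mapWord f w₂, _, _, hr.mapWord hf, ?_⟩)
    rcases h with ⟨rfl, rfl⟩ | ⟨rfl, rfl⟩
    · exact Or.inl ⟨by simp only [mapWord_append], by simp only [mapWord_append]⟩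
    · exact Or.inr ⟨by simp only [mapWord_append, mapWord_wordInv],
        by simp only [mapWord_append, mapWord_wordInv]⟩
  · refine Or.inr (Or.inr (Or.inl
      ⟨ArtinTits.mapWord f w₁, ArtinTits.mapWord f w₂, _, _, _, _,
      by simpa only [mapWord_append] using hr.mapWord hf,
      mapWord_ne_nil f hu, mapWord_ne_nil f hv, ?_, ?_⟩)) <;>
    simp only [mapWord_append, mapWord_wordInv]
  · refine Or.inr (Or.inr (Or.inr
      ⟨ArtinTits.mapWord f w₁, ArtinTits.mapWord f w₂, _, _, _, _,
      by simpa only [mapWord_append] using hr.mapWord hf,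
      mapWord_ne_nil f hu, mapWord_ne_nil f hv, ?_, ?_⟩)) <;>
    simp only [mapWord_append, mapWord_wordInv]

/-! ### Special transformations in context -/

theorem Steps012.append_append {A : ArtinData S} {w w' : Word S} (h : Steps012 A w w')
    (p q : Word S) : Steps012 A (p ++ w ++ q) (p ++ w' ++ q) := by
  refine Relation.ReflTransGen.lift (fun x => p ++ x ++ q) ?_ _ _ h
  rintro x y (⟨w₁, w₂, s, b, rfl, rfl⟩ | ⟨w₁, w₂, u, v, hr, h⟩ |
    ⟨w₁, w₂, u₁, u₂, v₁, v₂, hr, hu, hv, rfl, rfl⟩ | ⟨w₁, w₂, u₁, u₂, v₁, v₂, hr, hu, hv, rfl, rfl⟩)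
  · exact Or.inl ⟨p ++ w₁, w₂ ++ q, s, b, by simp, by simp⟩
  · refine Or.inr (Or.inl ⟨p ++ w₁, w₂ ++ q, u, v, hr, ?_⟩)
    rcases h with ⟨rfl, rfl⟩ | ⟨rfl, rfl⟩
    · exact Or.inl ⟨by simp, by simp⟩
    · exact Or.inr ⟨by simp, by simp⟩
  · exact Or.inr (Or.inr (Or.inl ⟨p ++ w₁, w₂ ++ q, _, _, _, _, hr, hu, hv, by simp, by simp⟩))
  · exact Or.inr (Or.inr (Or.inr ⟨p ++ w₁, w₂ ++ q, _, _, _, _, hr, hu, hv, by simp, by simp⟩))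

theorem Steps012.append {A : ArtinData S} {u u' v v' : Word S} (hu : Steps012 A u u')
    (hv : Steps012 A v v') : Steps012 A (u ++ v) (u' ++ v') := by
  have h1 := hu.append_append [] v
  have h2 := hv.append_append u' []
  simp only [List.nil_append, List.append_nil] at h1 h2
  exact h1.trans h2

theorem isRel_of_commute {A : ArtinData S} {x y : S} (hxy : x ≠ y) (hm : A.m x y = 2) :
    IsRel A [(x, true), (y, true)] [(y, true), (x, true)] :=
  ⟨x, y, 2, hxy, hm, rfl, rfl⟩

/-- Letters on generators with label `2` can be exchanged, whatever their signs. -/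
theorem steps012_swap {A : ArtinData S} {x y : S} (hxy : x ≠ y) (hm : A.m x y = 2) (b c : Bool) :
    Steps012 A [(x, b), (y, c)] [(y, c), (x, b)] := by
  have hr := isRel_of_commute hxy hm
  have hr' := isRel_of_commute hxy.symm (A.symm y x ▸ hm)
  refine Relation.ReflTransGen.single ?_
  cases b <;> cases c
  · exact Or.inr (Or.inl ⟨[], [], _, _, hr, Or.inr ⟨rfl, rfl⟩⟩)
  · exact Or.inr (Or.inr (Or.inl ⟨[], [], [(y, true)], [(x, true)], [(x, true)], [(y, true)], hr',
      by simp, by simp, rfl, rfl⟩))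
  · exact Or.inr (Or.inr (Or.inr ⟨[], [], [(x, true)], [(y, true)], [(y, true)], [(x, true)], hr,
      by simp, by simp, rfl, rfl⟩))
  · exact Or.inr (Or.inl ⟨[], [], _, _, hr', Or.inl ⟨rfl, rfl⟩⟩)

theorem steps012_commute {A : ArtinData S} {u v : Word S}
    (h : ∀ l ∈ u, ∀ l' ∈ v, l.1 ≠ l'.1 ∧ A.m l.1 l'.1 = 2) :
    Steps012 A (u ++ v) (v ++ u) := by
  have hletter (l : S × Bool) (v : Word S) (h : ∀ l' ∈ v, l.1 ≠ l'.1 ∧ A.m l.1 l'.1 = 2) :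
      Steps012 A (l :: v) (v ++ [l]) := by
    induction v with
    | nil => exact .refl
    | cons l' v ih =>
      have hl' := h l' (by simp)
      have h1 := (steps012_swap hl'.1 hl'.2 l.2 l'.2).append_append [] v
      have h2 := (ih fun a ha => h a (by simp [ha])).append_append [l'] []
      simp only [List.append_nil] at h2
      exact h1.trans h2
  induction u with
  | nil =>
    rw [List.nil_append, List.append_nil]
    exact .refl
  | cons l u ih =>
    have h1 := (ih fun a ha => h a (by simp [ha])).append_append [l] []
    have h2 := (hletter l v (h l (by simp))).append_append [] u
    simp only [List.append_nil, List.append_assoc, List.nil_append, List.cons_append] at h1 h2 ⊢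
    exact h1.trans h2

/-! ### Direct products -/

section Product

variable {S₁ S₂ : Type*} (A₁ : ArtinData S₁) (A₂ : ArtinData S₂)

theorem labelEmbedding_inl : LabelEmbedding A₁ (prodData A₁ A₂) Sum.inl :=
  ⟨Sum.inl_injective, fun _ _ => rfl⟩

theorem labelEmbedding_inr : LabelEmbedding A₂ (prodData A₁ A₂) Sum.inr :=
  ⟨Sum.inr_injective, fun _ _ => rfl⟩

theorem steps012_inl_inr (u : Word S₁) (v : Word S₂) :
    Steps012 (prodData A₁ A₂) (mapWord Sum.inl u ++ mapWord Sum.inr v)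
      (mapWord Sum.inr v ++ mapWord Sum.inl u) := by
  refine steps012_commute fun l hl l' hl' => ?_
  obtain ⟨a, -, rfl⟩ := List.mem_map.1 hl
  obtain ⟨b, -, rfl⟩ := List.mem_map.1 hl'
  exact ⟨Sum.inl_ne_inr, rfl⟩

theorem steps012_inr_inl (u : Word S₁) (v : Word S₂) :
    Steps012 (prodData A₁ A₂) (mapWord Sum.inr v ++ mapWord Sum.inl u)
      (mapWord Sum.inl u ++ mapWord Sum.inr v) := by
  refine steps012_commute fun l hl l' hl' => ?_
  obtain ⟨a, -, rfl⟩ := List.mem_map.1 hl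
  obtain ⟨b, -, rfl⟩ := List.mem_map.1 hl'
  exact ⟨Sum.inr_ne_inl, rfl⟩

theorem exists_hom_of_labelEmbedding {T : Type*} {A : ArtinData S} {B : ArtinData T} {f : S → T}
    (hf : LabelEmbedding A B f) :
    ∃ φ : ArtinGroup A →* ArtinGroup B,
      ∀ s, φ (wbar A [(s, true)]) = wbar B [(f s, true)] := by
  refine exists_hom_of_isRel A _ fun u v h => ?_
  have key : ∀ w, FreeGroup.lift (fun s => wbar B [(f s, true)]) (FreeGroup.mk w) =
      wbar B (mapWord f w) := by
    intro w
    rw [← lift_of_wbar B]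
    simp [FreeGroup.lift_mk, mapWord, Function.comp_def]
  rw [key, key]
  exact wbar_eq_of_isRel B (h.mapWord hf)

theorem exists_hom_prod :
    ∃ φ : ArtinGroup (prodData A₁ A₂) →* ArtinGroup A₁ × ArtinGroup A₂,
      ∀ s, φ (wbar _ [(s, true)]) =
        Sum.elim (fun a => (wbar A₁ [(a, true)], 1)) (fun b => (1, wbar A₂ [(b, true)])) s := by
  refine exists_hom_of_isRel _ _ ?_
  rintro u v ⟨s, t, k, hst, hm, rfl, rfl⟩
  rcases s with a | a <;> rcases t with b | b
  · have hr : IsRel A₁ (altWord a b k) (altWord b a k) :=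
      ⟨a, b, k, fun h => hst (congrArg _ h), hm, rfl, rfl⟩
    let ι := MonoidHom.inl (ArtinGroup A₁) (ArtinGroup A₂)
    refine (lift_altWord A₁ ι _ (s := Sum.inl a) (t := Sum.inl b) (s' := a) (t' := b)
      rfl rfl k).trans ?_
    rw [wbar_eq_of_isRel A₁ hr]
    exact (lift_altWord A₁ ι _ (s := Sum.inl b) (t := Sum.inl a) (s' := b) (t' := a)
      rfl rfl k).symm
  · obtain rfl : 2 = k := Nat.cast_injective (R := ℕ∞) hm
    simp [FreeGroup.lift_mk, altWord]
  · obtain rfl : 2 = k := Nat.cast_injective (R := ℕ∞) hm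
    simp [FreeGroup.lift_mk, altWord]
  · have hr : IsRel A₂ (altWord a b k) (altWord b a k) :=
      ⟨a, b, k, fun h => hst (congrArg _ h), hm, rfl, rfl⟩
    let ι := MonoidHom.inr (ArtinGroup A₁) (ArtinGroup A₂)
    refine (lift_altWord A₂ ι _ (s := Sum.inr a) (t := Sum.inr b) (s' := a) (t' := b)
      rfl rfl k).trans ?_
    rw [wbar_eq_of_isRel A₂ hr]
    exact (lift_altWord A₂ ι _ (s := Sum.inr b) (t := Sum.inr a) (s' := b) (t' := a)
      rfl rfl k).symm

/-- A group isomorphism compatible with the generators of the two factors. -/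
def IsStandardProdEquiv
    (e : ArtinGroup (prodData A₁ A₂) ≃* ArtinGroup A₁ × ArtinGroup A₂) : Prop :=
  (∀ a, e (wbar _ [(Sum.inl a, true)]) = (wbar A₁ [(a, true)], 1)) ∧
    ∀ b, e (wbar _ [(Sum.inr b, true)]) = (1, wbar A₂ [(b, true)])

theorem exists_isStandardProdEquiv : ∃ e, IsStandardProdEquiv A₁ A₂ e := by
  obtain ⟨φ, hφ⟩ := exists_hom_prod A₁ A₂
  obtain ⟨f, hf⟩ := exists_hom_of_labelEmbedding (labelEmbedding_inl A₁ A₂)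
  obtain ⟨g, hg⟩ := exists_hom_of_labelEmbedding (labelEmbedding_inr A₁ A₂)
  have comm_gen (a : S₁) (b : S₂) :
      Commute (f (wbar A₁ [(a, true)])) (g (wbar A₂ [(b, true)])) := by
    rw [hf, hg]
    exact wbar_eq_of_isRel _ (isRel_of_commute (A := prodData A₁ A₂) Sum.inl_ne_inr rfl)
  have comm (x : ArtinGroup A₁) (y : ArtinGroup A₂) : Commute (f x) (g y) := by
    have hx (b : S₂) : f x ∈ Subgroup.centralizer {g (wbar A₂ [(b, true)])} :=
      PresentedGroup.generated_by _ ((Subgroup.centralizer {g (wbar A₂ [(b, true)])}).comap f)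
        (fun a => Subgroup.mem_centralizer_singleton_iff.2 (comm_gen a b)) x
    have hy : g y ∈ Subgroup.centralizer {f x} :=
      PresentedGroup.generated_by _ ((Subgroup.centralizer {f x}).comap g)
        (fun b => Subgroup.mem_centralizer_singleton_iff.2
          (Subgroup.mem_centralizer_singleton_iff.1 (hx b)).symm) y
    exact (Subgroup.mem_centralizer_singleton_iff.1 hy).symm
  refine ⟨MonoidHom.toMulEquiv φ (f.noncommCoprod g comm) ?_ ?_, fun a => hφ _, fun b => hφ _⟩
  · refine hom_ext_wbar _ fun s => ?_
    rcases s with a | b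
    · simp [hφ, hf]
    · simp [hφ, hg]
  · have hφf : φ.comp f = MonoidHom.inl _ _ := hom_ext_wbar _ fun s => by simp [hφ, hf]
    have hφg : φ.comp g = MonoidHom.inr _ _ := hom_ext_wbar _ fun s => by simp [hφ, hg]
    refine MonoidHom.ext fun p => ?_
    have h1 := DFunLike.congr_fun hφf p.1
    have h2 := DFunLike.congr_fun hφg p.2
    simp only [MonoidHom.comp_apply] at h1 h2
    simp [h1, h2]

variable {A₁ A₂}
variable {e : ArtinGroup (prodData A₁ A₂) ≃* ArtinGroup A₁ × ArtinGroup A₂}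

namespace IsStandardProdEquiv

theorem map_inl_letter (he : IsStandardProdEquiv A₁ A₂ e) (a : S₁) (c : Bool) :
    e (wbar _ [(Sum.inl a, c)]) = (wbar A₁ [(a, c)], 1) := by
  cases c
  · rw [wbar_false, wbar_false, map_inv, he.1, Prod.inv_mk, inv_one]
  · exact he.1 a

theorem map_inr_letter (he : IsStandardProdEquiv A₁ A₂ e) (b : S₂) (c : Bool) :
    e (wbar _ [(Sum.inr b, c)]) = (1, wbar A₂ [(b, c)]) := by
  cases c
  · rw [wbar_false, wbar_false, map_inv, he.2, Prod.inv_mk, inv_one]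
  · exact he.2 b

theorem map_wbar_inl (he : IsStandardProdEquiv A₁ A₂ e) (w : Word S₁) :
    e (wbar _ (mapWord Sum.inl w)) = (wbar A₁ w, 1) := by
  induction w with
  | nil => exact map_one e
  | cons l w ih =>
    change e (wbar _ ((Sum.inl l.1, l.2) :: mapWord Sum.inl w)) = _
    rw [wbar_cons, map_mul, ih, he.map_inl_letter, wbar_cons A₁ l w, Prod.mk_mul_mk, one_mul]

theorem map_wbar_inr (he : IsStandardProdEquiv A₁ A₂ e) (w : Word S₂) :
    e (wbar _ (mapWord Sum.inr w)) = (1, wbar A₂ w) := by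
  induction w with
  | nil => exact map_one e
  | cons l w ih =>
    change e (wbar _ ((Sum.inr l.1, l.2) :: mapWord Sum.inr w)) = _
    rw [wbar_cons, map_mul, ih, he.map_inr_letter, wbar_cons A₂ l w, Prod.mk_mul_mk, one_mul]

/-- Every word can be transformed so that the letters of the first factor come first. -/
theorem exists_steps012 (he : IsStandardProdEquiv A₁ A₂ e) (w : Word (S₁ ⊕ S₂)) :
    ∃ w₁ w₂, Steps012 (prodData A₁ A₂) w (mapWord Sum.inl w₁ ++ mapWord Sum.inr w₂) ∧
      e (wbar _ w) = (wbar A₁ w₁, wbar A₂ w₂) := by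
  induction w with
  | nil => exact ⟨[], [], .refl, map_one e⟩
  | cons l w ih =>
    obtain ⟨w₁, w₂, hw, hew⟩ := ih
    have h := hw.append_append [l] []
    simp only [List.append_nil] at h
    rcases l with ⟨a | b, c⟩
    · refine ⟨(a, c) :: w₁, w₂, h, ?_⟩
      rw [wbar_cons, map_mul, hew, he.map_inl_letter, wbar_cons A₁ (a, c) w₁, Prod.mk_mul_mk,
        one_mul]
    · refine ⟨w₁, (b, c) :: w₂, h.trans ?_, ?_⟩
      · have := (steps012_inr_inl A₁ A₂ w₁ [(b, c)]).append_append [] (mapWord Sum.inr w₂)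
        simp only [mapWord, List.nil_append, List.append_assoc] at this
        exact this
      · rw [wbar_cons, map_mul, hew, he.map_inr_letter, wbar_cons A₂ (b, c) w₂, Prod.mk_mul_mk,
          one_mul]

theorem mem_parab_iff (he : IsStandardProdEquiv A₁ A₂ e) (U : Set (S₁ ⊕ S₂))
    (g : ArtinGroup (prodData A₁ A₂)) :
    g ∈ parab (prodData A₁ A₂) U ↔
      (e g).1 ∈ parab A₁ (Sum.inl ⁻¹' U) ∧ (e g).2 ∈ parab A₂ (Sum.inr ⁻¹' U) := by
  constructor
  · intro hg
    have : parab (prodData A₁ A₂) U ≤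
        ((parab A₁ (Sum.inl ⁻¹' U)).prod (parab A₂ (Sum.inr ⁻¹' U))).comap e.toMonoidHom := by
      refine (Subgroup.closure_le _).2 ?_
      rintro _ ⟨a | b, hs, rfl⟩
      · refine Subgroup.mem_comap.2 (Subgroup.mem_prod.2 ?_)
        change (e _).1 ∈ _ ∧ (e _).2 ∈ _
        rw [he.1]
        exact ⟨Subgroup.subset_closure ⟨a, hs, rfl⟩, one_mem _⟩
      · refine Subgroup.mem_comap.2 (Subgroup.mem_prod.2 ?_)
        change (e _).1 ∈ _ ∧ (e _).2 ∈ _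
        rw [he.2]
        exact ⟨one_mem _, Subgroup.subset_closure ⟨b, hs, rfl⟩⟩
    exact this hg
  · rintro ⟨h1, h2⟩
    have k1 : parab A₁ (Sum.inl ⁻¹' U) ≤ (parab (prodData A₁ A₂) U).comap
        (e.symm.toMonoidHom.comp (MonoidHom.inl _ _)) := by
      refine (Subgroup.closure_le _).2 ?_
      rintro _ ⟨a, hs, rfl⟩
      refine Subgroup.mem_comap.2 ?_
      change e.symm (wbar A₁ [(a, true)], 1) ∈ _
      rw [← he.1, e.symm_apply_apply]
      exact Subgroup.subset_closure ⟨_, hs, rfl⟩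
    have k2 : parab A₂ (Sum.inr ⁻¹' U) ≤ (parab (prodData A₁ A₂) U).comap
        (e.symm.toMonoidHom.comp (MonoidHom.inr _ _)) := by
      refine (Subgroup.closure_le _).2 ?_
      rintro _ ⟨b, hs, rfl⟩
      refine Subgroup.mem_comap.2 ?_
      change e.symm (1, wbar A₂ [(b, true)]) ∈ _
      rw [← he.2, e.symm_apply_apply]
      exact Subgroup.subset_closure ⟨_, hs, rfl⟩
    have hg : g = e.symm ((e g).1, 1) * e.symm (1, (e g).2) := by
      rw [← map_mul, Prod.mk_mul_mk, mul_one, one_mul, Prod.mk.eta, e.symm_apply_apply]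
    rw [hg]
    exact mul_mem (k1 h1) (k2 h2)

theorem isLeftTransversal (he : IsStandardProdEquiv A₁ A₂ e) (U : Set (S₁ ⊕ S₂))
    {T₁ : Set (ArtinGroup A₁)} {T₂ : Set (ArtinGroup A₂)}
    (h₁ : IsLeftTransversal (parab A₁ (Sum.inl ⁻¹' U)) T₁)
    (h₂ : IsLeftTransversal (parab A₂ (Sum.inr ⁻¹' U)) T₂) :
    IsLeftTransversal (parab (prodData A₁ A₂) U) (e ⁻¹' (T₁ ×ˢ T₂)) := by
  refine ⟨?_, fun g => ?_⟩
  · rw [Set.mem_preimage, map_one]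
    exact ⟨h₁.1, h₂.1⟩
  · obtain ⟨x₁, ⟨hx₁, hgx₁⟩, hu₁⟩ := h₁.2 (e g).1
    obtain ⟨x₂, ⟨hx₂, hgx₂⟩, hu₂⟩ := h₂.2 (e g).2
    refine ⟨e.symm (x₁, x₂), ⟨by simp [hx₁, hx₂], ?_⟩, ?_⟩
    · rw [he.mem_parab_iff, map_mul, map_inv, e.apply_symm_apply]
      exact ⟨hgx₁, hgx₂⟩
    · rintro y ⟨⟨hy₁, hy₂⟩, hgy⟩
      rw [he.mem_parab_iff, map_mul, map_inv] at hgy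
      rw [e.eq_symm_apply]
      exact Prod.ext (hu₁ _ ⟨hy₁, hgy.1⟩) (hu₂ _ ⟨hy₂, hgy.2⟩)

theorem propertyHSharpWrt (he : IsStandardProdEquiv A₁ A₂ e)
    {T₁ : Set S₁ → Set (ArtinGroup A₁)} {T₂ : Set S₂ → Set (ArtinGroup A₂)}
    (h₁ : PropertyHSharpWrt A₁ T₁) (h₂ : PropertyHSharpWrt A₂ T₂) :
    PropertyHSharpWrt (prodData A₁ A₂)
      fun U => e ⁻¹' (T₁ (Sum.inl ⁻¹' U) ×ˢ T₂ (Sum.inr ⁻¹' U)) := by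
  refine ⟨fun U => he.isLeftTransversal U (h₁.1 _) (h₂.1 _), fun S' S₀ w hw => ?_⟩
  obtain ⟨w₁, w₂, hsteps, hew⟩ := he.exists_steps012 w
  rw [he.mem_parab_iff, hew] at hw
  obtain ⟨v₁, u₁, hv₁, hu₁, hs₁, ht₁⟩ := h₁.2 _ (Sum.inl ⁻¹' S₀) w₁ hw.1
  obtain ⟨v₂, u₂, hv₂, hu₂, hs₂, ht₂⟩ := h₂.2 _ (Sum.inr ⁻¹' S₀) w₂ hw.2
  refine ⟨mapWord Sum.inl v₁ ++ mapWord Sum.inr v₂, mapWord Sum.inl u₁ ++ mapWord Sum.inr u₂,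
    (wordOver_mapWord _ hv₁).append (wordOver_mapWord _ hv₂),
    (wordOver_mapWord (U := S' ∩ S₀) _ hu₁).append (wordOver_mapWord _ hu₂), ?_, ?_⟩
  · have hparts := (hs₁.mapWord (labelEmbedding_inl A₁ A₂)).append
      (hs₂.mapWord (labelEmbedding_inr A₁ A₂))
    have hswap := (steps012_inl_inr A₁ A₂ u₁ v₂).append_append
      (mapWord Sum.inl v₁) (mapWord Sum.inr u₂)
    simp only [mapWord_append, List.append_assoc] at hparts hswap ⊢
    exact (hsteps.trans hparts).trans hswap
  · rw [Set.mem_preimage, wbar_append, map_mul, he.map_wbar_inl, he.map_wbar_inr, Prod.mk_mul_mk,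
      mul_one, one_mul]
    exact ⟨ht₁, ht₂⟩

end IsStandardProdEquiv

end Product

/-- Lemma 4.4: if two Artin–Tits presentations on disjoint generating sets
satisfy Property `H#`, then the presentation obtained by adding all commuting relations
between the two sides (whose group is the direct product of the two groups) satisfies
Property `H#`. -/
theorem stmt18 {S₁ S₂ : Type*} [Finite S₁] [Finite S₂]
    (A₁ : ArtinData S₁) (A₂ : ArtinData S₂)
    (h1 : PropertyHSharp A₁) (h2 : PropertyHSharp A₂) :
    Nonempty (ArtinGroup (prodData A₁ A₂) ≃* ArtinGroup A₁ × ArtinGroup A₂) ∧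
      PropertyHSharp (prodData A₁ A₂) := by
  obtain ⟨e, he⟩ := exists_isStandardProdEquiv A₁ A₂
  obtain ⟨T₁, hT₁⟩ := h1
  obtain ⟨T₂, hT₂⟩ := h2
  exact ⟨⟨e⟩, _, he.propertyHSharpWrt hT₁ hT₂⟩

end ArtinTits
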